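/- For all positive integers n and m, the Fox–Neuwirth complex D(n,m)_* is a chain complex: the composite d ∘ d of the differential with itself is zero. -/

import Mathlib

open scoped Classical

/-- A `(p,q)`-shuffle: a permutation of `Fin (p+q)` preserving the order on the first `p`
and on the last `q` elements. -/
def IsShuffle (p q : ℕ) (γ : Equiv.Perm (Fin (p + q))) : Prop :=
  ∀ x y : Fin (p + q), x < y → ((y : ℕ) < p ∨ p ≤ (x : ℕ)) → γ x < γ y

/-- The signed count of `(p,q)`-shuffles satisfying an extra property `P`. -/
noncomputable def shuffleSum (p q : ℕ) (P : Equiv.Perm (Fin (p + q)) → Prop) : ℤ :=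
  ∑ γ ∈ Finset.univ.filter (fun γ => IsShuffle p q γ ∧ P γ),
    ((Equiv.Perm.sign γ : ℤˣ) : ℤ)

/-- `c_{p,q}`: the sum of the signs of all `(p,q)`-shuffles. -/
noncomputable def cCoeff (p q : ℕ) : ℤ := shuffleSum p q fun _ => True

/-- `c_{(p,h),q,j}`: the signed count of `((p,h),q,j)`-shuffles, i.e. `(p,q)`-shuffles
sending `p+j+1` to `h+j+1` (in `1`-indexed terms). -/
noncomputable def cLCoeff (p h q j : ℕ) : ℤ :=
  shuffleSum p q fun γ => ∀ x : Fin (p + q), (x : ℕ) = p + j → ((γ x : ℕ) = h + j)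

/-- `c_{p,(q,h),j}`: the signed count of `(p,(q,h),j)`-shuffles, i.e. `(p,q)`-shuffles
sending `j+1` to `j+h+1` (in `1`-indexed terms). -/
noncomputable def cRCoeff (p q h j : ℕ) : ℤ :=
  shuffleSum p q fun γ => ∀ x : Fin (p + q), (x : ℕ) = j → ((γ x : ℕ) = j + h)

/-- Raw generators of the Fox–Neuwirth complex for `Conf_n(ℂ_m)` with `L` columns:
a triple `(λ, I, J)` of a tuple of column sizes, the positions of the fixed columns, and
the number of points below the fixed point in each fixed column. -/
abbrev FNGen (m L : ℕ) : Type := (Fin L → ℕ) × (Fin m → Fin L) × (Fin m → ℕ)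

/-- A generator `(λ, I, J)` is valid for parameters `(n, m)` when `λ` is a composition of
`n + m` (all parts positive), `I` is strictly increasing, and `0 ≤ j_k ≤ λ_{i_k} - 1`. -/
def FNValid (n m L : ℕ) (g : FNGen m L) : Prop :=
  (∀ i, 0 < g.1 i) ∧ (∑ i, g.1 i = n + m) ∧ StrictMono g.2.1 ∧
    ∀ k, g.2.2 k < g.1 (g.2.1 k)

/-- Degree-`(n + L - m)` part of the Fox–Neuwirth complex `D(n,m)` (indexed here by the
number `L` of columns): the free abelian group on the generators. -/
abbrev FNModule (m L : ℕ) : Type := FNGen m L →₀ ℤ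

/-- The coarsened composition obtained by merging columns `i` and `i+1`. -/
def FNlam {m L : ℕ} (g : FNGen m (L + 1)) (i : Fin L) : Fin L → ℕ := fun j =>
  if (j : ℕ) < (i : ℕ) then g.1 j.castSucc
  else if (j : ℕ) = (i : ℕ) then g.1 i.castSucc + g.1 i.succ
  else g.1 j.succ

/-- The new positions of the fixed columns after merging columns `i` and `i+1`. -/
def FNI {m L : ℕ} (g : FNGen m (L + 1)) (i : Fin L) : Fin m → Fin L := fun r =>
  if h : (g.2.1 r : ℕ) ≤ (i : ℕ) then ⟨(g.2.1 r : ℕ), lt_of_le_of_lt h i.isLt⟩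
  else ⟨(g.2.1 r : ℕ) - 1, by have h1 := (g.2.1 r).isLt; have h2 := i.isLt; omega⟩

/-- The new `J`-data: `j_k` is increased by `h` and the others are unchanged. -/
def FNJ {m L : ℕ} (g : FNGen m (L + 1)) (k : Fin m) (h : ℕ) : Fin m → ℕ := fun r =>
  if r = k then g.2.2 r + h else g.2.2 r

/-- The Fox–Neuwirth differential on a generator: the signed sum over all merges of two
adjacent columns, with coefficients `c_{p,q}` for two free columns, `c_{(p,h),q,j}` for a
free column merged into a fixed column on its right, `c_{p,(q,h),j}` for a fixed column
merged with a free column on its right, and `0` when both columns are fixed. -/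
noncomputable def FNdGen (n m L : ℕ) (g : FNGen m (L + 1)) : FNModule m L :=
  if FNValid n m (L + 1) g then
    ∑ i : Fin L,
      (if hk : ∃ r, g.2.1 r = i.castSucc then
        (if ∃ r, g.2.1 r = i.succ then (0 : FNModule m L)
         else ∑ h ∈ Finset.range (g.1 i.succ + 1),
          ((-1 : ℤ) ^ (i : ℕ) * cRCoeff (g.1 i.castSucc) (g.1 i.succ) h (g.2.2 hk.choose)) •
            Finsupp.single (FNlam g i, FNI g i, FNJ g hk.choose h) 1)
      else if hk' : ∃ r, g.2.1 r = i.succ then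
        ∑ h ∈ Finset.range (g.1 i.castSucc + 1),
          ((-1 : ℤ) ^ (i : ℕ) * cLCoeff (g.1 i.castSucc) h (g.1 i.succ) (g.2.2 hk'.choose)) •
            Finsupp.single (FNlam g i, FNI g i, FNJ g hk'.choose h) 1
      else ((-1 : ℤ) ^ (i : ℕ) * cCoeff (g.1 i.castSucc) (g.1 i.succ)) •
        Finsupp.single (FNlam g i, FNI g i, g.2.2) 1)
  else 0

/-- The Fox–Neuwirth differential `d : D(n,m)_q → D(n,m)_{q-1}`. -/
noncomputable def FNd (n m L : ℕ) (x : FNModule m (L + 1)) : FNModule m L :=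
  x.sum fun g z => z • FNdGen n m L g


/-! ### Shuffles as permutations of a larger set -/

/-- Extend a permutation of `Fin N` by the identity. -/
def pext {N : ℕ} (γ : Equiv.Perm (Fin N)) : ℕ → ℕ := fun x =>
  if h : x < N then (γ ⟨x, h⟩ : ℕ) else x

/-- Shift a self-map of `ℕ` by `a`. -/
def pshift (a : ℕ) (f : ℕ → ℕ) : ℕ → ℕ := fun x => if x < a then x else a + f (x - a)

lemma pshift_zero (f : ℕ → ℕ) : pshift 0 f = f := by
  funext x; simp [pshift]

lemma pext_lt {N : ℕ} (γ : Equiv.Perm (Fin N)) {x : ℕ} (h : x < N) : pext γ x < N := by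
  simp [pext, h]

lemma pext_val {N : ℕ} (γ : Equiv.Perm (Fin N)) (x : Fin N) : pext γ x = γ x := by
  simp [pext]

lemma pext_mul {N : ℕ} (γ δ : Equiv.Perm (Fin N)) : pext (γ * δ) = pext γ ∘ pext δ := by
  funext x
  by_cases h : x < N <;> simp [pext, h]

lemma pext_inj {N : ℕ} {γ δ : Equiv.Perm (Fin N)} (h : pext γ = pext δ) : γ = δ := by
  ext x
  rw [← pext_val, ← pext_val, h]

/-- The interval of `Fin N` starting at `a` of length `k`. -/
def intervalEquiv (a k N : ℕ) (h : a + k ≤ N) :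
    Fin k ≃ {x : Fin N // a ≤ (x : ℕ) ∧ (x : ℕ) < a + k} where
  toFun x := ⟨⟨a + x, by omega⟩, by simp⟩
  invFun y := ⟨(y : Fin N) - a, by have := y.2; omega⟩
  left_inv x := by ext; simp
  right_inv y := by ext; have := y.2; simp; omega

/-- Place a permutation of `Fin k` on the interval `[a, a+k)`. -/
def pembed (a k N : ℕ) (h : a + k ≤ N) (γ : Equiv.Perm (Fin k)) : Equiv.Perm (Fin N) :=
  γ.extendDomain (intervalEquiv a k N h)

lemma sign_pembed (a k N : ℕ) (h : a + k ≤ N) (γ : Equiv.Perm (Fin k)) :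
    Equiv.Perm.sign (pembed a k N h γ) = Equiv.Perm.sign γ := by
  simp [pembed]

lemma pext_pembed (a k N : ℕ) (h : a + k ≤ N) (γ : Equiv.Perm (Fin k)) :
    pext (pembed a k N h γ) = pshift a (pext γ) := by
  funext x
  by_cases hx : x < N
  · by_cases h2 : a ≤ x ∧ x < a + k
    · have := Equiv.Perm.extendDomain_apply_subtype γ (intervalEquiv a k N h) (b := ⟨x, hx⟩) h2
      simp only [pext, hx, dif_pos, pembed, this]
      have h3 : x - a < k := by omega
      have h4 : ¬ x < a := by omega
      simp [intervalEquiv, pshift, pext, h3, h4]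
    · have := Equiv.Perm.extendDomain_apply_not_subtype γ (intervalEquiv a k N h)
        (b := ⟨x, hx⟩) h2
      simp only [pext, hx, dif_pos, pembed, this, pshift]
      split_ifs <;> omega
  · have h3 : ¬ x - a < k := by omega
    simp only [pext, hx, dif_neg, pshift, h3, not_false_eq_true]
    split_ifs <;> omega

/-- `σ` is increasing on `[u, v)`. -/
def MonoIn {N : ℕ} (u v : ℕ) (σ : Equiv.Perm (Fin N)) : Prop :=
  ∀ x y : Fin N, u ≤ (x : ℕ) → x < y → (y : ℕ) < v → σ x < σ y

/-- `σ` is the identity outside `[u, v)`. -/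
def FixOut {N : ℕ} (u v : ℕ) (σ : Equiv.Perm (Fin N)) : Prop :=
  ∀ x : Fin N, ((x : ℕ) < u ∨ v ≤ (x : ℕ)) → σ x = x

lemma FixOut.inv {N u v : ℕ} {σ : Equiv.Perm (Fin N)} (h : FixOut u v σ) : FixOut u v σ⁻¹ := by
  intro x hx
  rw [Equiv.Perm.inv_eq_iff_eq]; exact (h x hx).symm

lemma FixOut.mul {N u v : ℕ} {σ τ : Equiv.Perm (Fin N)} (h : FixOut u v σ) (h' : FixOut u v τ) :
    FixOut u v (σ * τ) := by
  intro x hx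
  rw [Equiv.Perm.mul_apply, h' x hx, h x hx]

lemma FixOut.mem {N u v : ℕ} {σ : Equiv.Perm (Fin N)} (h : FixOut u v σ) {x : Fin N}
    (h1 : u ≤ (x : ℕ)) (h2 : (x : ℕ) < v) : u ≤ (σ x : ℕ) ∧ (σ x : ℕ) < v := by
  by_contra hc
  have h3 : σ (σ x) = σ x := h (σ x) (by omega)
  have h4 := σ.injective h3
  rw [h4] at hc
  exact hc ⟨h1, h2⟩

lemma fixOut_pembed (a k N : ℕ) (h : a + k ≤ N) (γ : Equiv.Perm (Fin k)) :
    FixOut a (a + k) (pembed a k N h γ) := by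
  intro x hx
  exact Equiv.Perm.extendDomain_apply_not_subtype γ (intervalEquiv a k N h) (by omega)

lemma pembed_surj (a k N : ℕ) (h : a + k ≤ N) (σ : Equiv.Perm (Fin N))
    (hσ : FixOut a (a + k) σ) : ∃ γ, pembed a k N h γ = σ := by
  have key : ∀ τ : Equiv.Perm (Fin N), FixOut a (a + k) τ → ∀ x : Fin k,
      a ≤ (τ ⟨a + x, by omega⟩ : ℕ) ∧ (τ ⟨a + x, by omega⟩ : ℕ) < a + k :=
    fun τ hτ x => hτ.mem (by simp) (by simp)
  refine ⟨⟨fun x => ⟨σ ⟨a + x, by omega⟩ - a, by have := key σ hσ x; omega⟩,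
    fun x => ⟨σ⁻¹ ⟨a + x, by omega⟩ - a, by have := key _ hσ.inv x; omega⟩, ?_, ?_⟩, ?_⟩
  · intro x
    ext
    have := key σ hσ x
    have e : (⟨a + (σ ⟨a + x, by omega⟩ - a : ℕ), by omega⟩ : Fin N) = σ ⟨a + x, by omega⟩ := by
      ext; simp; omega
    simp [e]
  · intro x
    ext
    have := key _ hσ.inv x
    have e : (⟨a + (σ⁻¹ ⟨a + x, by omega⟩ - a : ℕ), by omega⟩ : Fin N) = σ⁻¹ ⟨a + x, by omega⟩ := by
      ext; simp; simp at this; omega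
    simp only [e]
    simp
  · apply pext_inj
    rw [pext_pembed]
    funext x
    by_cases hx : x < N
    · by_cases h2 : a ≤ x ∧ x < a + k
      · have h3 : x - a < k := by omega
        have h4 : ¬ x < a := by omega
        have e : a + (x - a) = x := by omega
        have := hσ.mem (x := ⟨x, hx⟩) h2.1 h2.2
        simp only [pshift, pext, h3, h4, hx, dif_pos, if_neg, not_false_eq_true, e,
          Equiv.coe_fn_mk]
        omega
      · have := hσ ⟨x, hx⟩ (by simp; omega)
        simp only [pshift, pext, hx, dif_pos, this]
        split_ifs <;> omega
    · have h3 : ¬ x - a < k := by omega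
      simp only [pext, hx, dif_neg, pshift, h3, not_false_eq_true]
      split_ifs <;> omega

lemma exists_sort {N : ℕ} (u v : ℕ) (hv : v ≤ N) (huv : u ≤ v) (σ : Equiv.Perm (Fin N)) :
    ∃ τ, FixOut u v τ ∧ MonoIn u v (σ * τ) := by
  obtain ⟨k, rfl⟩ := Nat.exists_eq_add_of_le huv
  let f : Fin k → Fin N := fun x => σ ⟨u + x, by omega⟩
  have hm := Tuple.monotone_sort f
  refine ⟨pembed u k N hv (Tuple.sort f), fixOut_pembed _ _ _ _ _, ?_⟩
  intro x y hx hxy hy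
  have hlt : (x : ℕ) < y := hxy
  refine lt_of_le_of_ne ?_ (fun h => hxy.ne ((σ * _).injective h))
  have ev : ∀ z : Fin N, ∀ h1 : u ≤ (z : ℕ), ∀ h2 : (z : ℕ) < u + k,
      (σ * pembed u k N hv (Tuple.sort f)) z = f (Tuple.sort f ⟨z - u, by omega⟩) := by
    intro z h1 h2
    simp only [Equiv.Perm.mul_apply, f]
    congr 1
    ext
    rw [← pext_val, pext_pembed]
    have h3 : ¬ (z : ℕ) < u := by omega
    have h4 : (z : ℕ) - u < k := by omega
    simp [pshift, pext, h3, h4]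
  rw [ev x hx (by omega), ev y (by omega) hy]
  exact hm (by simp [Fin.le_def]; omega)

/-- Decomposition of permutations into a permutation increasing on `[u, v)` and one supported
on `[u, v)`. -/
lemma sum_decomp {M : Type*} [AddCommGroup M] {N : ℕ} (u v : ℕ) (hv : v ≤ N) (huv : u ≤ v)
    (P Q R : Equiv.Perm (Fin N) → Prop)
    (hPQR : ∀ γ γ', FixOut u v γ → MonoIn u v γ' → (R (γ' * γ) ↔ (P γ ∧ Q γ')))
    (F : Equiv.Perm (Fin N) → M) :
    ∑ γ ∈ Finset.univ.filter (fun γ => FixOut u v γ ∧ P γ),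
      ((Equiv.Perm.sign γ : ℤˣ) : ℤ) •
      ∑ γ' ∈ Finset.univ.filter (fun γ' => MonoIn u v γ' ∧ Q γ'),
        ((Equiv.Perm.sign γ' : ℤˣ) : ℤ) • F (γ' * γ) =
    ∑ σ ∈ Finset.univ.filter R, ((Equiv.Perm.sign σ : ℤˣ) : ℤ) • F σ := by
  simp_rw [Finset.smul_sum]
  rw [← Finset.sum_product']
  refine Finset.sum_bij (fun x _ => x.2 * x.1) ?_ ?_ ?_ ?_
  · rintro ⟨γ, γ'⟩ h
    simp only [Finset.mem_product, Finset.mem_filter, Finset.mem_univ, true_and] at h ⊢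
    exact (hPQR γ γ' h.1.1 h.2.1).2 ⟨h.1.2, h.2.2⟩
  · rintro ⟨γ, γ'⟩ h ⟨δ, δ'⟩ h' e
    simp only [Finset.mem_product, Finset.mem_filter, Finset.mem_univ, true_and] at h h' e
    have hρ : FixOut u v (γ * δ⁻¹) := h.1.1.mul h'.1.1.inv
    have e2 : δ' = γ' * (γ * δ⁻¹) := by
      rw [← mul_assoc, e, mul_inv_cancel_right]
    have hlt : ∀ x y : Fin N, u ≤ (x : ℕ) → x < y → (y : ℕ) < v →
        (γ * δ⁻¹) x < (γ * δ⁻¹) y := by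
      intro x y hx hxy hy
      have hxy' : (x : ℕ) < y := hxy
      have h1 := h'.2.1 x y hx hxy hy
      rw [e2] at h1
      by_contra hc
      rcases eq_or_lt_of_le (not_lt.1 hc) with h2 | h2
      · exact hxy.ne ((γ * δ⁻¹).injective h2).symm
      · have h3 := h.2.1 _ _ (hρ.mem (by omega) hy).1 h2 (hρ.mem hx (by omega)).2
        exact absurd h1 (not_lt.2 h3.le)
    have hsm : StrictMono (γ * δ⁻¹) := by
      intro x y hxy
      have hxy' : (x : ℕ) < y := hxy
      by_cases hx : u ≤ (x : ℕ) ∧ (x : ℕ) < v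
      · by_cases hy : (y : ℕ) < v
        · exact hlt x y hx.1 hxy hy
        · rw [hρ y (by omega)]
          have := hρ.mem hx.1 hx.2
          rw [Fin.lt_def]; omega
      · rw [hρ x (by omega)]
        by_cases hy : u ≤ (y : ℕ) ∧ (y : ℕ) < v
        · have := hρ.mem hy.1 hy.2
          rw [Fin.lt_def]; omega
        · rw [hρ y (by omega)]; exact hxy
    have hone : γ * δ⁻¹ = 1 := by
      ext x
      have := hsm.id_le
      have hh : ∀ z, z ≤ (γ * δ⁻¹) z := fun z => hsm.le_apply
      have h2 : ∀ z, z ≥ (γ * δ⁻¹) z := fun z => hsm.apply_le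
      simpa using congrArg Fin.val (le_antisymm (h2 x) (hh x))
    have e3 : γ = δ := by
      rwa [mul_inv_eq_one] at hone
    subst e3
    rw [mul_left_inj] at e
    rw [e]
  · intro σ hσ
    obtain ⟨τ, h1, h2⟩ := exists_sort u v hv huv σ
    have e : σ * τ * τ⁻¹ = σ := by simp
    refine ⟨(τ⁻¹, σ * τ), ?_, e⟩
    have h3 := (hPQR _ _ h1.inv h2).1 (by rw [e]; simpa using hσ)
    simp [h1.inv, h2, h3]
  · rintro ⟨γ, γ'⟩ h
    simp only [Equiv.Perm.sign_mul, Units.val_mul, smul_smul]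
    rw [mul_comm]

/-- Signed sum over `(p,q)`-shuffles. -/
noncomputable def shSum {M : Type*} [AddCommGroup M] (p q : ℕ) (F : (ℕ → ℕ) → M) : M :=
  ∑ γ ∈ Finset.univ.filter (fun γ => IsShuffle p q γ),
    ((Equiv.Perm.sign γ : ℤˣ) : ℤ) • F (pext γ)

lemma isShuffle_pembed (a p q N : ℕ) (h : a + (p + q) ≤ N) (γ : Equiv.Perm (Fin (p + q))) :
    IsShuffle p q γ ↔ (MonoIn a (a + p) (pembed a (p + q) N h γ) ∧
      MonoIn (a + p) (a + (p + q)) (pembed a (p + q) N h γ)) := by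
  have ev : ∀ z : Fin N, ∀ h1 : a ≤ (z : ℕ), ∀ h2 : (z : ℕ) < a + (p + q),
      (pembed a (p + q) N h γ z : ℕ) = a + γ ⟨z - a, by omega⟩ := by
    intro z h1 h2
    rw [← pext_val, pext_pembed]
    have h3 : ¬ (z : ℕ) < a := by omega
    have h4 : (z : ℕ) - a < p + q := by omega
    simp [pshift, pext, h3, h4]
  constructor
  · intro hs
    constructor
    · intro x y hx hxy hy
      have hxy' : (x : ℕ) < y := hxy
      rw [Fin.lt_def, ev x hx (by omega), ev y (by omega) (by omega)]
      have := hs ⟨x - a, by omega⟩ ⟨y - a, by omega⟩ (by simp [Fin.lt_def]; omega)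
        (by left; simp; omega)
      rw [Fin.lt_def] at this
      omega
    · intro x y hx hxy hy
      have hxy' : (x : ℕ) < y := hxy
      rw [Fin.lt_def, ev x (by omega) (by omega), ev y (by omega) (by omega)]
      have := hs ⟨x - a, by omega⟩ ⟨y - a, by omega⟩ (by simp [Fin.lt_def]; omega)
        (by right; simp; omega)
      rw [Fin.lt_def] at this
      omega
  · rintro ⟨h1, h2⟩ x y hxy hor
    have hxy' : (x : ℕ) < y := hxy
    have hE : ∀ z : Fin (p + q), (pembed a (p + q) N h γ ⟨a + z, by omega⟩ : ℕ) = a + γ z := by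
      intro z
      rw [ev _ (by simp) (by simp)]; simp
    rcases hor with hor | hor
    · have := h1 ⟨a + x, by omega⟩ ⟨a + y, by omega⟩ (by simp) (Fin.mk_lt_mk.2 (by omega))
        (by simp; omega)
      rw [Fin.lt_def, hE, hE] at this
      rw [Fin.lt_def]; omega
    · have := h2 ⟨a + x, by omega⟩ ⟨a + y, by omega⟩ (by simp; omega)
        (Fin.mk_lt_mk.2 (by omega)) (by simp)
      rw [Fin.lt_def, hE, hE] at this
      rw [Fin.lt_def]; omega

lemma shSum_embed {M : Type*} [AddCommGroup M] (a p q N : ℕ) (h : a + (p + q) ≤ N)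
    (F : (ℕ → ℕ) → M) :
    shSum p q (fun f => F (pshift a f)) =
    ∑ σ ∈ Finset.univ.filter (fun σ : Equiv.Perm (Fin N) => FixOut a (a + (p + q)) σ ∧
      (MonoIn a (a + p) σ ∧ MonoIn (a + p) (a + (p + q)) σ)),
      ((Equiv.Perm.sign σ : ℤˣ) : ℤ) • F (pext σ) := by
  unfold shSum
  refine Finset.sum_bij (fun γ _ => pembed a (p + q) N h γ) ?_ ?_ ?_ ?_
  · intro γ hγ
    simp only [Finset.mem_filter, Finset.mem_univ, true_and] at hγ ⊢
    exact ⟨fixOut_pembed _ _ _ _ _, (isShuffle_pembed a p q N h γ).1 hγ⟩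
  · intro γ _ δ _ e
    exact Equiv.Perm.extendDomainHom_injective _ e
  · intro σ hσ
    simp only [Finset.mem_filter, Finset.mem_univ, true_and] at hσ
    obtain ⟨γ, rfl⟩ := pembed_surj a (p + q) N h σ hσ.1
    exact ⟨γ, by simpa using (isShuffle_pembed a p q N h γ).2 hσ.2, rfl⟩
  · intro γ _
    rw [sign_pembed, pext_pembed]

/-- The sum over shuffles of the whole of `Fin N`. -/
lemma shSum_full {M : Type*} [AddCommGroup M] (p q N : ℕ) (h : p + q = N)
    (F : (ℕ → ℕ) → M) :
    shSum p q F =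
    ∑ σ ∈ Finset.univ.filter (fun σ : Equiv.Perm (Fin N) => MonoIn 0 p σ ∧ MonoIn p N σ),
      ((Equiv.Perm.sign σ : ℤˣ) : ℤ) • F (pext σ) := by
  subst h
  have := shSum_embed 0 p q (p + q) (by omega) F
  simp only [pshift_zero, zero_add] at this
  rw [this]
  congr 1
  ext σ
  simp only [Finset.mem_filter, Finset.mem_univ, true_and, and_iff_right_iff_imp]
  intro _ x hx
  omega

lemma monoIn_mul_inside {N u v a b : ℕ} {γ γ' : Equiv.Perm (Fin N)} (hγ : FixOut u v γ)
    (hγ' : MonoIn u v γ') (ha : u ≤ a) (hb : b ≤ v) : MonoIn a b (γ' * γ) ↔ MonoIn a b γ := by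
  constructor
  · intro h x y hx hxy hy
    have hxy' : (x : ℕ) < y := hxy
    have h1 := h x y hx hxy hy
    by_contra hc
    rcases eq_or_lt_of_le (not_lt.1 hc) with h2 | h2
    · exact hxy.ne (γ.injective h2).symm
    · have h3 := hγ' _ _ (hγ.mem (by omega) (by omega)).1 h2 (hγ.mem (by omega) (by omega)).2
      exact absurd h1 (not_lt.2 h3.le)
  · intro h x y hx hxy hy
    have hxy' : (x : ℕ) < y := hxy
    exact hγ' _ _ (hγ.mem (by omega) (by omega)).1 (h x y hx hxy hy)
      (hγ.mem (by omega) (by omega)).2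

lemma monoIn_mul_outside {N u v a b : ℕ} {γ γ' : Equiv.Perm (Fin N)} (hγ : FixOut u v γ)
    (hab : b ≤ u ∨ v ≤ a) : MonoIn a b (γ' * γ) ↔ MonoIn a b γ' := by
  constructor
  · intro h x y hx hxy hy
    have hxy' : (x : ℕ) < y := hxy
    have h1 := h x y hx hxy hy
    rwa [Equiv.Perm.mul_apply, Equiv.Perm.mul_apply, hγ x (by omega), hγ y (by omega)] at h1
  · intro h x y hx hxy hy
    have hxy' : (x : ℕ) < y := hxy
    rw [Equiv.Perm.mul_apply, Equiv.Perm.mul_apply, hγ x (by omega), hγ y (by omega)]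
    exact h x y hx hxy hy

/-- Associativity of signed shuffles. -/
lemma shSum_assoc {M : Type*} [AddCommGroup M] (p q r : ℕ) (F : (ℕ → ℕ) → M) :
    shSum p q (fun f => shSum (p + q) r (fun f' => F (f' ∘ f))) =
    shSum q r (fun f => shSum p (q + r) (fun f' => F (f' ∘ pshift p f))) := by
  let N := p + q + r
  obtain ⟨R, hR⟩ : ∃ R : Equiv.Perm (Fin N) → Prop, ∀ σ, R σ ↔
    (MonoIn 0 p σ ∧ MonoIn p (p + q) σ ∧ MonoIn (p + q) N σ) := ⟨_, fun _ => Iff.rfl⟩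
  trans ∑ σ ∈ Finset.univ.filter R, ((Equiv.Perm.sign σ : ℤˣ) : ℤ) • F (pext σ)
  · have h1 := shSum_embed 0 p q N (by omega)
      (fun f => shSum (p + q) r (fun f' => F (f' ∘ f)))
    simp only [pshift_zero, zero_add] at h1
    rw [h1]
    simp only [shSum_full (p + q) r N rfl, ← pext_mul]
    refine Eq.trans ?_ (sum_decomp 0 (p + q) (by omega) (by omega)
      (fun σ => MonoIn 0 p σ ∧ MonoIn p (p + q) σ) (fun σ => MonoIn (p + q) N σ) R ?_
      (fun σ => F (pext σ)))
    · congr!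
    intro γ γ' h1 h2
    rw [hR]
    rw [monoIn_mul_inside h1 h2 (by omega) (by omega),
      monoIn_mul_inside h1 h2 (by omega) (by omega), monoIn_mul_outside h1 (by omega)]
    tauto
  · have h1 := shSum_embed p q r N (by omega)
      (fun f => shSum p (q + r) (fun f' => F (f' ∘ f)))
    rw [h1]
    have e : p + (q + r) = N := by simp only [N]; omega
    simp only [shSum_full p (q + r) N e, ← pext_mul]
    refine ((Eq.trans ?_ (sum_decomp p N (by omega) (by omega)
      (fun σ => MonoIn p (p + q) σ ∧ MonoIn (p + q) N σ) (fun σ => MonoIn 0 p σ) R ?_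
      (fun σ => F (pext σ))))).symm
    · refine Finset.sum_congr ?_ fun γ _ => ?_
      · ext γ
        simp only [Finset.mem_filter, e]
      · congr 1
        refine Finset.sum_congr ?_ fun γ _ => rfl
        ext γ
        simp only [Finset.mem_filter, and_comm]
    intro γ γ' h1 h2
    rw [hR]
    rw [monoIn_mul_outside (a := 0) h1 (by omega), monoIn_mul_inside h1 h2 (by omega) (by omega),
      monoIn_mul_inside h1 h2 (by omega) (by omega)]
    tauto

lemma shSum_comm {M : Type*} [AddCommGroup M] (p q p' q' : ℕ) (F : (ℕ → ℕ) → (ℕ → ℕ) → M) :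
    shSum p q (fun f => shSum p' q' (fun f' => F f f')) =
    shSum p' q' (fun f' => shSum p q (fun f => F f f')) := by
  unfold shSum
  simp_rw [Finset.smul_sum]
  rw [Finset.sum_comm]
  exact Finset.sum_congr rfl fun _ _ => Finset.sum_congr rfl fun _ _ => smul_comm _ _ _

lemma map_shSum {M M' : Type*} [AddCommGroup M] [AddCommGroup M'] (φ : M →ₗ[ℤ] M') (p q : ℕ)
    (F : (ℕ → ℕ) → M) : φ (shSum p q F) = shSum p q (fun f => φ (F f)) := by
  simp [shSum, map_sum]

lemma shSum_congr {M : Type*} [AddCommGroup M] (p q : ℕ) (F F' : (ℕ → ℕ) → M)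
    (h : ∀ f : ℕ → ℕ, (∀ x, x < p + q → f x < p + q) → (∀ x, p + q ≤ x → f x = x) →
      F f = F' f) : shSum p q F = shSum p q F' := by
  refine Finset.sum_congr rfl fun γ _ => ?_
  rw [h]
  · intro x hx; exact pext_lt γ hx
  · intro x hx; simp [pext, not_lt.2 hx]

lemma shSum_zero {M : Type*} [AddCommGroup M] (p q : ℕ) :
    shSum p q (fun _ => (0 : M)) = 0 := by
  simp [shSum]

/-! ### Merging two columns along a shuffle -/

/-- Column `c` is a fixed column. -/
def FxCol {m L : ℕ} (g : FNGen m L) (c : ℕ) : Prop := ∃ r, (g.2.1 r : ℕ) = c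

/-- The new heights of the fixed points after a shuffle. -/
def newJ {m L : ℕ} (g : FNGen m (L + 1)) (i : Fin L) (f : ℕ → ℕ) : Fin m → ℕ := fun r =>
  if (g.2.1 r : ℕ) = i then f (g.2.2 r)
  else if (g.2.1 r : ℕ) = i + 1 then f (g.1 i.castSucc + g.2.2 r) else g.2.2 r

/-- Merge columns `i` and `i+1` along `f`. -/
def mergeGen {m L : ℕ} (g : FNGen m (L + 1)) (i : Fin L) (f : ℕ → ℕ) : FNGen m L :=
  (FNlam g i, FNI g i, newJ g i f)

/-- The `i`-th face of a generator. -/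
noncomputable def face (n m L : ℕ) (i : Fin L) (g : FNGen m (L + 1)) : FNModule m L :=
  if FNValid n m (L + 1) g ∧ ¬ (FxCol g i ∧ FxCol g (i + 1)) then
    shSum (g.1 i.castSucc) (g.1 i.succ) (fun f => Finsupp.single (mergeGen g i f) 1)
  else 0

lemma FNI_val {m L : ℕ} (g : FNGen m (L + 1)) (i : Fin L) (r : Fin m) :
    (FNI g i r : ℕ) = if (g.2.1 r : ℕ) ≤ i then (g.2.1 r : ℕ) else g.2.1 r - 1 := by
  unfold FNI
  split_ifs <;> rfl

lemma exists_natFun {L : ℕ} (l : Fin L → ℕ) : ∃ l' : ℕ → ℕ, l = fun x : Fin L => l' (x : ℕ) :=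
  ⟨fun x => if h : x < L then l ⟨x, h⟩ else 0, by funext x; simp⟩

lemma FxCol_merge {m L : ℕ} (g : FNGen m (L + 1)) (i : Fin L) (f : ℕ → ℕ) (c : ℕ) :
    FxCol (mergeGen g i f) c ↔
      ((c ≤ i ∧ FxCol g c) ∨ ((i : ℕ) ≤ c ∧ FxCol g (c + 1))) := by
  unfold FxCol mergeGen
  simp only [FNI_val]
  constructor
  · rintro ⟨r, hr⟩
    split_ifs at hr with h
    · exact Or.inl ⟨by omega, r, hr⟩
    · exact Or.inr ⟨by omega, r, by omega⟩
  · rintro (⟨h, r, hr⟩ | ⟨h, r, hr⟩)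
    · exact ⟨r, by rw [if_pos (by omega), hr]⟩
    · exact ⟨r, by rw [if_neg (by omega)]; omega⟩

lemma sum_FNlam {m L : ℕ} (g : FNGen m (L + 1)) (i : Fin L) :
    ∑ c, FNlam g i c = ∑ c, g.1 c := by
  rw [Fin.sum_univ_succAbove g.1 i.succ]
  rw [Finset.sum_eq_sum_sdiff_singleton_add (Finset.mem_univ i)
    (fun c => g.1 (i.succ.succAbove c)), Finset.sum_eq_sum_sdiff_singleton_add (Finset.mem_univ i)
    (fun c => FNlam g i c)]
  have h1 : FNlam g i i = g.1 i.castSucc + g.1 i.succ := by simp [FNlam]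
  have h2 : i.succ.succAbove i = i.castSucc := by simp
  have h3 : ∀ c ∈ Finset.univ \ {i}, FNlam g i c = g.1 (i.succ.succAbove c) := by
    intro c hc
    have hc : c ≠ i := by simpa using hc
    have hc' : (c : ℕ) ≠ i := fun h => hc (Fin.ext h)
    unfold FNlam
    by_cases h : (c : ℕ) < i
    · rw [if_pos h, Fin.succAbove_of_castSucc_lt]
      rw [Fin.lt_def]; simp; omega
    · rw [if_neg h, if_neg hc', Fin.succAbove_of_le_castSucc]
      rw [Fin.le_def]; simp; omega
  rw [Finset.sum_congr rfl h3, h1, h2]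
  ring

lemma valid_merge {n m L : ℕ} (g : FNGen m (L + 1)) (i : Fin L) (f : ℕ → ℕ)
    (hg : FNValid n m (L + 1) g) (hfx : ¬ (FxCol g i ∧ FxCol g (i + 1)))
    (hf : ∀ x, x < g.1 i.castSucc + g.1 i.succ → f x < g.1 i.castSucc + g.1 i.succ) :
    FNValid n m L (mergeGen g i f) := by
  obtain ⟨h1, h2, h3, h4⟩ := hg
  refine ⟨?_, ?_, ?_, ?_⟩
  · intro c
    have := h1 c.castSucc
    have := h1 c.succ
    have := h1 i.succ
    simp only [mergeGen, FNlam]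
    split_ifs <;> omega
  · rw [← h2]; exact sum_FNlam g i
  · intro r s hrs
    have h5 : (g.2.1 r : ℕ) < g.2.1 s := h3 hrs
    have h6 : ¬ ((g.2.1 r : ℕ) = i ∧ (g.2.1 s : ℕ) = i + 1) := fun h =>
      hfx ⟨⟨r, h.1⟩, ⟨s, h.2⟩⟩
    rw [Fin.lt_def]
    simp only [mergeGen, FNI_val]
    split_ifs <;> omega
  · intro r
    have h5 := h4 r
    have h7 := FNI_val g i r
    simp only [mergeGen, newJ, FNlam]
    obtain ⟨l, I, J⟩ := g
    obtain ⟨l, rfl⟩ := exists_natFun l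
    simp only [Fin.val_castSucc, Fin.val_succ] at *
    have a1 := hf (J r)
    have a2 := hf (l i + J r)
    grind

/-- `a b c` disjoint merges commute. -/
lemma merge_merge_lt {m L : ℕ} (g : FNGen m (L + 2)) (i j : Fin L) (hij : i < j)
    (f f' : ℕ → ℕ) :
    mergeGen (mergeGen g j.succ f) i f' = mergeGen (mergeGen g i.castSucc f') j f := by
  have hij : (i : ℕ) < j := hij
  obtain ⟨l, I, J⟩ := g
  obtain ⟨l, rfl⟩ := exists_natFun l
  refine Prod.ext ?_ (Prod.ext ?_ ?_)
  · funext c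
    simp only [mergeGen, FNlam, Fin.val_castSucc, Fin.val_succ]
    grind
  · funext r
    ext
    simp only [mergeGen, FNI_val, Fin.val_castSucc, Fin.val_succ]
    grind
  · funext r
    simp only [mergeGen, newJ, FNlam, FNI_val, Fin.val_castSucc, Fin.val_succ]
    grind (splits := 25)

lemma merge_merge_eq {m L : ℕ} (g : FNGen m (L + 2)) (i : Fin L)
    (hg : ∀ k, g.2.2 k < g.1 (g.2.1 k))
    (f f' h h' : ℕ → ℕ)
    (hf : ∀ x, g.1 i.castSucc.castSucc + g.1 i.castSucc.succ ≤ x → f x = x)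
    (hh : f' ∘ f = h' ∘ pshift (g.1 i.castSucc.castSucc) h) :
    mergeGen (mergeGen g i.succ h) i h' = mergeGen (mergeGen g i.castSucc f) i f' := by
  have hh : ∀ x, f' (f x) = h' (if x < g.1 i.castSucc.castSucc then x else
      g.1 i.castSucc.castSucc + h (x - g.1 i.castSucc.castSucc)) := fun x => congrFun hh x
  obtain ⟨l, I, J⟩ := g
  obtain ⟨l, rfl⟩ := exists_natFun l
  refine Prod.ext ?_ (Prod.ext ?_ ?_)
  · funext c
    simp only [mergeGen, FNlam, Fin.val_castSucc, Fin.val_succ]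
    grind
  · funext r
    ext
    simp only [mergeGen, FNI_val, Fin.val_castSucc, Fin.val_succ]
    grind
  · funext r
    have hr := hg r
    simp only [mergeGen, newJ, FNlam, FNI_val, Fin.val_castSucc, Fin.val_succ] at *
    have a1 := hh (J r)
    have a2 := hh (l i + J r)
    have a3 := hh (l i + l (i + 1) + J r)
    have b3 := hf (l i + l (i + 1) + J r)
    grind

/-- The `i`-th face map. -/
noncomputable def faceL (n m L : ℕ) (i : Fin L) : FNModule m (L + 1) →ₗ[ℤ] FNModule m L :=
  Finsupp.linearCombination ℤ (face n m L i)

lemma faceL_single (n m L : ℕ) (i : Fin L) (g : FNGen m (L + 1)) :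
    faceL n m L i (Finsupp.single g 1) = face n m L i g := by
  simp [faceL]

lemma faceL_face (n m L : ℕ) (i : Fin L) (j : Fin (L + 1)) (g : FNGen m (L + 2))
    (hg : FNValid n m (L + 2) g) (hfx : ¬ (FxCol g j ∧ FxCol g (j + 1))) :
    faceL n m L i (face n m (L + 1) j g) =
      shSum (g.1 j.castSucc) (g.1 j.succ) (fun f => 
        if FxCol (mergeGen g j f) i ∧ FxCol (mergeGen g j f) (i + 1) then 0 else
          shSum (FNlam g j i.castSucc) (FNlam g j i.succ) (fun f' =>
            Finsupp.single (mergeGen (mergeGen g j f) i f') 1)) := by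
  rw [face, if_pos ⟨hg, hfx⟩, map_shSum]
  refine shSum_congr _ _ _ _ fun f h1 h2 => ?_
  rw [faceL_single, face]
  have := valid_merge g j f hg hfx h1
  by_cases hc : FxCol (mergeGen g j f) i ∧ FxCol (mergeGen g j f) (i + 1)
  · rw [if_pos hc, if_neg (fun h => h.2 hc)]
  · rw [if_neg hc, if_pos ⟨this, hc⟩]
    rfl

lemma face_eq_zero (n m L : ℕ) (j : Fin L) (g : FNGen m (L + 1))
    (hfx : (FxCol g j ∧ FxCol g (j + 1))) : face n m L j g = 0 := by
  rw [face, if_neg (fun h => h.2 hfx)]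

lemma face_face (n m L : ℕ) (i j : Fin L) (hij : i ≤ j) (g : FNGen m (L + 2)) :
    faceL n m L i (face n m (L + 1) j.succ g) =
      faceL n m L j (face n m (L + 1) i.castSucc g) := by
  by_cases hg : FNValid n m (L + 2) g
  swap
  · rw [face, face, if_neg (fun h => hg h.1), if_neg (fun h => hg h.1)]; simp
  rcases eq_or_lt_of_le hij with rfl | hij
  · have z1 : (FxCol g (i.succ : Fin (L + 1)) ∧ FxCol g ((i.succ : Fin (L + 1)) + 1)) ∨
        (FxCol g i ∧ FxCol g (i + 1)) ∨ (FxCol g i ∧ FxCol g (i + 2)) →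
        faceL n m L i (face n m (L + 1) i.succ g) = 0 := by
      intro h
      by_cases h1 : FxCol g (i.succ : Fin (L + 1)) ∧ FxCol g ((i.succ : Fin (L + 1)) + 1)
      · rw [face_eq_zero _ _ _ _ _ h1]; simp
      · rw [faceL_face _ _ _ _ _ _ hg h1]
        refine Eq.trans (shSum_congr _ _ _ _ fun f _ _ => if_pos ?_) (shSum_zero _ _)
        simp only [FxCol_merge, Fin.val_succ] at *
        grind
    have z2 : (FxCol g (i.succ : Fin (L + 1)) ∧ FxCol g ((i.succ : Fin (L + 1)) + 1)) ∨
        (FxCol g i ∧ FxCol g (i + 1)) ∨ (FxCol g i ∧ FxCol g (i + 2)) →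
        faceL n m L i (face n m (L + 1) i.castSucc g) = 0 := by
      intro h
      by_cases h1 : FxCol g (i.castSucc : Fin (L + 1)) ∧ FxCol g ((i.castSucc : Fin (L + 1)) + 1)
      · rw [face_eq_zero _ _ _ _ _ h1]; simp
      · rw [faceL_face _ _ _ _ _ _ hg h1]
        refine Eq.trans (shSum_congr _ _ _ _ fun f _ _ => if_pos ?_) (shSum_zero _ _)
        simp only [FxCol_merge, Fin.val_succ, Fin.val_castSucc] at *
        grind
    by_cases hz : (FxCol g (i.succ : Fin (L + 1)) ∧ FxCol g ((i.succ : Fin (L + 1)) + 1)) ∨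
        (FxCol g i ∧ FxCol g (i + 1)) ∨ (FxCol g i ∧ FxCol g (i + 2))
    · rw [z1 hz, z2 hz]
    · simp only [Fin.val_succ] at hz
      rw [faceL_face _ _ _ _ _ _ hg (by simp only [Fin.val_succ]; grind),
        faceL_face _ _ _ _ _ _ hg (by simp only [Fin.val_castSucc]; grind)]
      let p := g.1 i.castSucc.castSucc
      let q := g.1 i.castSucc.succ
      let r := g.1 i.succ.succ
      -- explicit description of the double merge in terms of the composite
      let Jc : (ℕ → ℕ) → FNModule m L := fun h =>
        Finsupp.single (mergeGen (mergeGen g i.castSucc (fun x => x)) i h) 1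
      have hJ := merge_merge_eq g i hg.2.2.2
      have e1 : FNlam g i.succ i.castSucc = p := by simp [FNlam, p]
      have e2 : FNlam g i.succ i.succ = q + r := by simp [FNlam, q, r]
      have e3 : FNlam g i.castSucc i.castSucc = p + q := by simp [FNlam, p, q]
      have e4 : FNlam g i.castSucc i.succ = r := by simp [FNlam, r]
      rw [e1, e2, e3, e4]
      have key := shSum_assoc p q r Jc
      refine Eq.trans ?_ (key.symm.trans ?_)
      · refine shSum_congr _ _ _ _ fun h _ _ => ?_
        rw [if_neg]
        · refine shSum_congr _ _ _ _ fun h' _ _ => ?_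
          simp only [Jc]
          rw [hJ (fun x => x) (h' ∘ pshift p h) h h' (fun _ _ => rfl) rfl]
        · simp only [FxCol_merge, Fin.val_succ] at *
          grind
      · refine shSum_congr _ _ _ _ fun f _ hf => ?_
        rw [if_neg]
        · refine shSum_congr _ _ _ _ fun f' _ _ => ?_
          simp only [Jc]
          rw [← hJ (fun x => x) (f' ∘ f) (fun x => x) (f' ∘ f) (fun _ _ => rfl) ?_,
            hJ f f' (fun x => x) (f' ∘ f) hf]
          · funext x
            simp only [pshift, Function.comp]
            split_ifs with h
            · rfl
            · congr 2
              have : g.1 i.castSucc.castSucc ≤ x := not_lt.1 h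
              omega
          · funext x
            simp only [pshift, Function.comp]
            split_ifs with h
            · rfl
            · congr 2
              have : g.1 i.castSucc.castSucc ≤ x := not_lt.1 h
              omega
        · simp only [FxCol_merge, Fin.val_castSucc] at *
          grind
  · have hij' : (i : ℕ) < j := hij
    by_cases h1 : FxCol g (j.succ : Fin (L + 1)) ∧ FxCol g ((j.succ : Fin (L + 1)) + 1)
    · rw [face_eq_zero _ _ _ _ _ h1, map_zero]
      symm
      by_cases h2 : FxCol g (i.castSucc : Fin (L + 1)) ∧ FxCol g ((i.castSucc : Fin (L + 1)) + 1)
      · rw [face_eq_zero _ _ _ _ _ h2]; simp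
      · rw [faceL_face _ _ _ _ _ _ hg h2]
        refine Eq.trans (shSum_congr _ _ _ _ fun f _ _ => if_pos ?_) (shSum_zero _ _)
        simp only [FxCol_merge, Fin.val_succ, Fin.val_castSucc] at *
        grind
    by_cases h2 : FxCol g (i.castSucc : Fin (L + 1)) ∧ FxCol g ((i.castSucc : Fin (L + 1)) + 1)
    · rw [face_eq_zero _ _ _ _ _ h2, map_zero]
      rw [faceL_face _ _ _ _ _ _ hg h1]
      refine Eq.trans (shSum_congr _ _ _ _ fun f _ _ => if_pos ?_) (shSum_zero _ _)
      simp only [FxCol_merge, Fin.val_succ, Fin.val_castSucc] at *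
      grind
    · rw [faceL_face _ _ _ _ _ _ hg h1, faceL_face _ _ _ _ _ _ hg h2]
      have e1 : FNlam g j.succ i.castSucc = g.1 i.castSucc.castSucc := by
        simp [FNlam]; omega
      have e2 : FNlam g j.succ i.succ = g.1 i.castSucc.succ := by
        simp [FNlam]; omega
      have e3 : FNlam g i.castSucc j.castSucc = g.1 j.succ.castSucc := by
        simp [FNlam]; grind
      have e4 : FNlam g i.castSucc j.succ = g.1 j.succ.succ := by
        simp [FNlam]; grind
      rw [e1, e2, e3, e4]
      refine Eq.trans (shSum_congr _ _ _ _ fun f _ _ => if_neg ?_) ?_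
      · simp only [FxCol_merge, Fin.val_succ, Fin.val_castSucc] at *
        grind
      refine Eq.trans ?_ (shSum_congr _ _ _ _ fun f _ _ => (if_neg ?_).symm)
      · rw [shSum_comm]
        simp only [merge_merge_lt g i j hij]
      · simp only [FxCol_merge, Fin.val_succ, Fin.val_castSucc] at *
        grind

/-- Cancellation in a double alternating sum. -/
lemma alt_sum {M : Type*} [AddCommGroup M] (L : ℕ) (a : Fin L → Fin (L + 1) → M)
    (ha : ∀ i j : Fin L, i ≤ j → a i j.succ = a j i.castSucc) :
    ∑ j : Fin (L + 1), ∑ i : Fin L, ((-1 : ℤ) ^ (j : ℕ) * (-1 : ℤ) ^ (i : ℕ)) • a i j = 0 := by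
  rw [Finset.sum_comm]
  have h1 : ∀ i : Fin L, ∑ j : Fin (L + 1), ((-1 : ℤ) ^ (j : ℕ) * (-1 : ℤ) ^ (i : ℕ)) • a i j =
      (∑ j : Fin L, if i ≤ j then ((-1 : ℤ) ^ (j + 1 : ℕ) * (-1 : ℤ) ^ (i : ℕ)) • a i j.succ
        else 0) +
      ∑ j : Fin L, if j ≤ i then ((-1 : ℤ) ^ (j : ℕ) * (-1 : ℤ) ^ (i : ℕ)) • a i j.castSucc
        else 0 := by
    intro i
    rw [Fin.sum_univ_succAbove _ i.castSucc]
    rw [← Finset.add_sum_erase (s := Finset.univ) (a := i)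
      (f := fun j : Fin L => if j ≤ i then _ else _) (Finset.mem_univ i)]
    rw [if_pos le_rfl, add_left_comm]
    congr 1
    rw [← Finset.sum_filter, ← Finset.sum_filter]
    rw [← Finset.sum_filter_add_sum_filter_not Finset.univ (fun j => i ≤ j)]
    congr 1
    · refine Finset.sum_congr rfl fun j hj => ?_
      have hj : i ≤ j := by simpa using hj
      rw [Fin.succAbove_of_le_castSucc _ _ (by simpa using hj)]
      simp
    · refine Finset.sum_congr ?_ fun j hj => ?_
      · ext j
        simp
        grind
      · have hj : j ≠ i ∧ j ≤ i := by simpa using hj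
        rw [Fin.succAbove_of_castSucc_lt _ _ (by simpa using lt_of_le_of_ne hj.2 hj.1)]
        simp
  rw [Finset.sum_congr rfl fun i _ => h1 i, Finset.sum_add_distrib]
  rw [Finset.sum_comm, ← Finset.sum_add_distrib]
  refine Finset.sum_eq_zero fun j _ => ?_
  rw [← Finset.sum_add_distrib]
  refine Finset.sum_eq_zero fun i _ => ?_
  by_cases h : i ≤ j
  · rw [if_pos h, if_pos h, ha i j h, ← add_smul, pow_succ]
    convert zero_smul ℤ _
    ring
  · simp [h]

/-! ### The differential as alternating sum of faces -/

lemma gap_of_mono {f : ℕ → ℕ} {a b : ℕ} (hf : ∀ x y, a ≤ x → x < y → y < b → f x < f y) (x d : ℕ)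
    (hx : a ≤ x) (hd : x + d < b) : f x + d ≤ f (x + d) := by
  induction d with
  | zero => simp
  | succ d ih =>
    have := ih (by omega)
    have := hf (x + d) (x + (d + 1)) (by omega) (by omega) hd
    omega

lemma shuffle_mono {p q : ℕ} {γ : Equiv.Perm (Fin (p + q))} (h : IsShuffle p q γ) (x y : ℕ)
    (hxy : x < y) (hy : y < p + q) (hor : y < p ∨ p ≤ x) : pext γ x < pext γ y := by
  have := h ⟨x, by omega⟩ ⟨y, hy⟩ (Fin.mk_lt_mk.2 hxy) hor
  have hx : x < p + q := by omega
  simpa [pext, hx, hy] using this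

lemma shuffle_left {p q : ℕ} {γ : Equiv.Perm (Fin (p + q))} (h : IsShuffle p q γ) (j : ℕ)
    (hj : j < p) : j ≤ pext γ j ∧ pext γ j ≤ j + q := by
  have hm : ∀ x y, 0 ≤ x → x < y → y < p → pext γ x < pext γ y := fun x y _ hxy hy =>
    shuffle_mono h x y hxy (by omega) (Or.inl hy)
  have h1 := gap_of_mono hm 0 j (by omega) (by omega)
  have h2 := gap_of_mono hm j (p - 1 - j) (by omega) (by omega)
  have h3 := pext_lt γ (x := j + (p - 1 - j)) (by omega)
  rw [zero_add] at h1
  omega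

lemma shuffle_right {p q : ℕ} {γ : Equiv.Perm (Fin (p + q))} (h : IsShuffle p q γ) (j : ℕ)
    (hj : j < q) : j ≤ pext γ (p + j) ∧ pext γ (p + j) ≤ p + j := by
  have hm : ∀ x y, p ≤ x → x < y → y < p + q → pext γ x < pext γ y := fun x y hx hxy hy =>
    shuffle_mono h x y hxy (by omega) (Or.inr hx)
  have h1 := gap_of_mono hm p j (by omega) (by omega)
  have h2 := gap_of_mono hm (p + j) (q - 1 - j) (by omega) (by omega)
  have h3 := pext_lt γ (x := p + j + (q - 1 - j)) (by omega)
  omega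

/-- Grouping shuffles by the value at a point. -/
lemma shSum_fiber {M : Type*} [AddCommGroup M] (p q x b K : ℕ) (hx : x < p + q)
    (hb : ∀ γ, IsShuffle p q γ → b ≤ pext γ x ∧ pext γ x ≤ b + K)
    (F : (ℕ → ℕ) → M) (G : ℕ → M) (hFG : ∀ f h, f x = b + h → F f = G h) :
    shSum p q F = ∑ h ∈ Finset.range (K + 1),
      (shuffleSum p q fun γ => ∀ y : Fin (p + q), (y : ℕ) = x → (γ y : ℕ) = b + h) • G h := by
  unfold shSum shuffleSum
  rw [← Finset.sum_fiberwise_of_maps_to (s := Finset.univ.filter (fun γ => IsShuffle p q γ))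
    (t := Finset.range (K + 1)) (g := fun γ => pext γ x - b)]
  · refine Finset.sum_congr rfl fun h hh => ?_
    rw [Finset.sum_smul]
    refine Finset.sum_congr ?_ fun γ hγ => ?_
    · ext γ
      simp only [Finset.mem_filter, Finset.mem_univ, true_and]
      refine and_congr_right fun hs => ?_
      have h1 := hb γ hs
      constructor
      · rintro h2 y rfl
        rw [← pext_val]; omega
      · intro h2
        have := h2 ⟨x, hx⟩ rfl
        rw [← pext_val] at this
        simp only at this
        omega
    · simp only [Finset.mem_filter, Finset.mem_univ, true_and] at hγ
      have := hγ.2 ⟨x, hx⟩ rfl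
      rw [← pext_val] at this
      rw [hFG _ h this]
  · intro γ hγ
    have := hb γ (by simpa using hγ)
    rw [Finset.mem_range]; omega

lemma FNdGen_eq (n m L : ℕ) (g : FNGen m (L + 1)) :
    FNdGen n m L g = ∑ i : Fin L, ((-1 : ℤ) ^ (i : ℕ)) • face n m L i g := by
  unfold FNdGen
  by_cases hg : FNValid n m (L + 1) g
  swap
  · rw [if_neg hg]
    symm
    refine Finset.sum_eq_zero fun i _ => ?_
    rw [face, if_neg (fun h => hg h.1), smul_zero]
  rw [if_pos hg]
  refine Finset.sum_congr rfl fun i _ => ?_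
  have c1 : (∃ r, g.2.1 r = i.castSucc) ↔ FxCol g i := by
    simp [FxCol, Fin.ext_iff]
  have c2 : (∃ r, g.2.1 r = i.succ) ↔ FxCol g (i + 1) := by
    simp [FxCol, Fin.ext_iff]
  have hinj := hg.2.2.1.injective
  by_cases hk : ∃ r, g.2.1 r = i.castSucc
  · rw [dif_pos hk]
    by_cases hk' : ∃ r, g.2.1 r = i.succ
    · rw [if_pos hk', face_eq_zero _ _ _ _ _ ⟨c1.1 hk, c2.1 hk'⟩, smul_zero]
    · rw [if_neg hk', face, if_pos ⟨hg, fun h => hk' (c2.2 h.2)⟩]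
      have hs := hk.choose_spec
      generalize hk.choose = k at hs ⊢
      have hJ := hg.2.2.2 k
      rw [hs] at hJ
      rw [shSum_fiber _ _ (g.2.2 k) (g.2.2 k) (g.1 i.succ) (by omega)
        (fun γ h => shuffle_left h _ hJ) _
        (fun h => Finsupp.single (FNlam g i, FNI g i, FNJ g k h) 1), Finset.smul_sum]
      · refine Finset.sum_congr rfl fun h _ => ?_
        rw [smul_smul]; rfl
      · intro f h hf
        rw [mergeGen]
        congr 3
        funext r
        unfold newJ FNJ
        by_cases hr : r = k
        · subst hr; simp [hs, hf]
        · have h1 : ¬ (g.2.1 r : ℕ) = i := fun h => hr (hinj (by rw [hs]; ext; simpa using h))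
          have h2 : ¬ (g.2.1 r : ℕ) = i + 1 := fun h => hk' (c2.2 ⟨r, h⟩)
          simp [hr, h1, h2]
  · rw [dif_neg hk, face, if_pos ⟨hg, fun h => hk (c1.2 h.1)⟩]
    by_cases hk' : ∃ r, g.2.1 r = i.succ
    · rw [dif_pos hk']
      have hs := hk'.choose_spec
      generalize hk'.choose = k at hs ⊢
      have hJ := hg.2.2.2 k
      rw [hs] at hJ
      rw [shSum_fiber _ _ (g.1 i.castSucc + g.2.2 k) (g.2.2 k) (g.1 i.castSucc) (by omega)
        (fun γ h => by have := shuffle_right h _ hJ; omega) _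
        (fun h => Finsupp.single (FNlam g i, FNI g i, FNJ g k h) 1), Finset.smul_sum]
      · refine Finset.sum_congr rfl fun h _ => ?_
        rw [smul_smul, cLCoeff, add_comm h]
      · intro f h hf
        rw [mergeGen]
        congr 3
        funext r
        unfold newJ FNJ
        by_cases hr : r = k
        · subst hr; simp [hs, hf]
        · have h1 : ¬ (g.2.1 r : ℕ) = i + 1 := fun h => hr (hinj (by rw [hs]; ext; simpa using h))
          have h2 : ¬ (g.2.1 r : ℕ) = i := fun h => hk (c1.2 ⟨r, h⟩)
          simp [hr, h1, h2]
    · rw [dif_neg hk', mul_smul]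
      congr 1
      have e : ∀ f, mergeGen g i f = (FNlam g i, FNI g i, g.2.2) := by
        intro f
        rw [mergeGen]
        congr 2
        funext r
        have h1 : ¬ (g.2.1 r : ℕ) = i + 1 := fun h => hk' (c2.2 ⟨r, h⟩)
        have h2 : ¬ (g.2.1 r : ℕ) = i := fun h => hk (c1.2 ⟨r, h⟩)
        simp [newJ, h1, h2]
      simp only [e, shSum, cCoeff, shuffleSum, ← Finset.sum_smul, and_true]

lemma FNd_eq (n m L : ℕ) (x : FNModule m (L + 1)) :
    FNd n m L x = ∑ i : Fin L, ((-1 : ℤ) ^ (i : ℕ)) • faceL n m L i x := by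
  have : FNd n m L x = Finsupp.linearCombination ℤ (FNdGen n m L) x := rfl
  rw [this]
  have h : Finsupp.linearCombination ℤ (FNdGen n m L) =
      ∑ i : Fin L, ((-1 : ℤ) ^ (i : ℕ)) • faceL n m L i := by
    refine Finsupp.lhom_ext' fun g => LinearMap.ext_ring ?_
    simp [FNdGen_eq, faceL, LinearMap.sum_apply]
  rw [h]
  simp [LinearMap.sum_apply]

lemma faceL_faceL (n m L : ℕ) (i j : Fin L) (hij : i ≤ j) (x : FNModule m (L + 2)) :
    faceL n m L i (faceL n m (L + 1) j.succ x) =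
      faceL n m L j (faceL n m (L + 1) i.castSucc x) := by
  have h : (faceL n m L i) ∘ₗ (faceL n m (L + 1) j.succ) =
      (faceL n m L j) ∘ₗ (faceL n m (L + 1) i.castSucc) := by
    refine Finsupp.lhom_ext' fun g => LinearMap.ext_ring ?_
    simp only [LinearMap.comp_apply, Finsupp.lsingle_apply, faceL_single]
    exact face_face n m L i j hij g
  exact LinearMap.congr_fun h x

/-- The Fox–Neuwirth complex is a chain complex: `d ∘ d = 0`. -/
theorem FNd_squared (n m : ℕ) (hn : 0 < n) (hm : 0 < m) (L : ℕ)
    (x : FNModule m (L + 2)) :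
    FNd n m L (FNd n m (L + 1) x) = 0 := by
  rw [FNd_eq n m (L + 1) x, FNd_eq]
  have := alt_sum L (fun i j => faceL n m L i (faceL n m (L + 1) j x))
    (fun i j hij => faceL_faceL n m L i j hij x)
  rw [Finset.sum_comm] at this
  rw [← this]
  refine Finset.sum_congr rfl fun i _ => ?_
  rw [map_sum, Finset.smul_sum]
  refine Finset.sum_congr rfl fun j _ => ?_
  rw [map_smul, smul_smul, mul_comm]
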